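/- arXiv:2205.14078 — 7 statements merged into one kernel-verified Lean document; each statement's English description precedes it below -/
import Mathlib

section
/- For all n ∈ ℕ and all k ∈ ℕ with 0 ≤ k ≤ n, the type B q-Stirling number of the second kind satisfies S_B[n,k] = h_{n−k}([1]_q, [3]_q, …, [2k+1]_q), the (n−k)-th complete homogeneous symmetric polynomial evaluated at the k+1 odd q-integers [1]_q, [3]_q, …, [2k+1]_q. Moreover S_B[n,k] = 0 whenever k > n. -/
open Polynomial Finset

/-- The q-integer [m]_q = 1 + q + ... + q^(m-1) in ℤ[q]. -/
noncomputable def qInt (m : ℕ) : Polynomial ℤ := ∑ i ∈ Finset.range m, Polynomial.X ^ i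

/-- Type B q-Stirling numbers of the second kind. -/
noncomputable def SB : ℕ → ℕ → Polynomial ℤ
  | 0, k => if k = 0 then 1 else 0
  | n+1, 0 => qInt 1 * SB n 0
  | n+1, k+1 => SB n k + qInt (2*(k+1)+1) * SB n (k+1)

/-- The j-th complete homogeneous symmetric polynomial in x 0, ..., x (m-1). -/
noncomputable def hsym {R : Type*} [CommRing R] (x : ℕ → R) (m j : ℕ) : R :=
  ∑ t ∈ (Finset.range m).sym j, ((t : Multiset ℕ).map x).prod

theorem hsym_zero_right {R : Type*} [CommRing R] (x : ℕ → R) (m : ℕ) : hsym x m 0 = 1 := by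
  simp [hsym]
  exact Multiset.prod_zero

theorem hsym_zero_left {R : Type*} [CommRing R] (x : ℕ → R) (j : ℕ) : hsym x 0 (j+1) = 0 := by
  simp [hsym]

theorem hsym_succ {R : Type*} [CommRing R] (x : ℕ → R) (m j : ℕ) :
    hsym x (m+1) (j+1) = hsym x m (j+1) + x m * hsym x (m+1) j := by
  have hset : (Finset.range (m+1)).sym (j+1) =
      (Finset.range m).sym (j+1) ∪ ((Finset.range (m+1)).sym j).image (fun t => m ::ₛ t) := by
    ext t
    simp only [Finset.mem_union, Finset.mem_image, Finset.mem_sym_iff, Finset.mem_range]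
    constructor
    · intro h
      by_cases hm : m ∈ t
      · right
        obtain ⟨u, rfl⟩ := Sym.exists_cons_of_mem hm
        exact ⟨u, fun a ha => h a (Sym.mem_cons_of_mem ha), rfl⟩
      · left
        intro a ha
        have h1 := h a ha
        have h2 : a ≠ m := fun e => hm (e ▸ ha)
        omega
    · rintro (h | ⟨u, hu, rfl⟩) a ha
      · have := h a ha
        omega
      · rcases Sym.mem_cons.1 ha with rfl | ha
        · omega
        · exact hu a ha
  have hdisj : Disjoint ((Finset.range m).sym (j+1))
      (((Finset.range (m+1)).sym j).image (fun t => m ::ₛ t)) := by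
    rw [Finset.disjoint_left]
    intro t ht ht'
    obtain ⟨u, _, rfl⟩ := Finset.mem_image.1 ht'
    have := Finset.mem_sym_iff.1 ht m (Sym.mem_cons_self m u)
    simp at this
  unfold hsym
  rw [hset, Finset.sum_union hdisj, Finset.sum_image
    (fun a _ b _ h => (Sym.cons_inj_right m a b).1 h), Finset.mul_sum]
  congr 1
  refine Finset.sum_congr rfl fun t _ => ?_
  have h : ((m ::ₛ t : Sym ℕ (j+1)) : Multiset ℕ) = m ::ₘ (t : Multiset ℕ) := rfl
  exact (congrArg (fun s => (Multiset.map x s).prod) h).trans (by simp)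

theorem SB_eq_hsym (n k : ℕ) :
    (k ≤ n → SB n k = hsym (fun i => qInt (2*i+1)) (k+1) (n - k)) ∧
    (n < k → SB n k = 0) := by
  induction n generalizing k with
  | zero =>
    refine ⟨fun h => ?_, fun h => ?_⟩
    · obtain rfl : k = 0 := by omega
      simp [SB, hsym_zero_right]
    · simp [SB, Nat.ne_of_gt h]
  | succ n ih =>
    cases k with
    | zero =>
      refine ⟨fun _ => ?_, fun h => by omega⟩
      have h := (ih 0).1 (Nat.zero_le n)
      simp only [Nat.sub_zero, Nat.zero_add] at h ⊢
      rw [SB, h, ← Nat.zero_add 1, hsym_succ, hsym_zero_left]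
      simp
    | succ k =>
      refine ⟨fun hk => ?_, fun hk => ?_⟩
      · have hk' : k ≤ n := by omega
        rw [SB, (ih k).1 hk', Nat.add_sub_add_right]
        rcases hk'.eq_or_lt with rfl | hlt
        · rw [(ih (k+1)).2 (by omega)]
          simp [hsym_zero_right]
        · rw [(ih (k+1)).1 hlt]
          obtain ⟨j, rfl⟩ := Nat.exists_eq_add_of_lt hlt
          rw [show k + j + 1 - k = j + 1 by omega, show k + j + 1 - (k + 1) = j by omega,
            hsym_succ _ (k+1) j]
      · rw [SB, (ih k).2 (by omega), (ih (k+1)).2 (by omega)]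
        simp
end

section
/- For every n ∈ ℕ, in the polynomial ring (ℤ[q])[t] one has t^n = Σ_{k=0}^n S_B[n,k] · (t;q)↓_k^B, where (t;q)↓_k^B = (t − [1]_q)(t − [3]_q)⋯(t − [2k−1]_q) is the type B q-falling factorial (with (t;q)↓_0^B = 1). -/
open Polynomial Finset

theorem SB_eq_zero_of_lt (n : ℕ) : ∀ k, n < k → SB n k = 0 := by
  induction n with
  | zero =>
    intro k hk
    have : k ≠ 0 := by omega
    simp [SB, this]
  | succ n ih =>
    intro k hk
    cases k with
    | zero => omega
    | succ k => simp [SB, ih k (by omega), ih (k+1) (by omega)]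

theorem pow_eq_sum_SB_qFallingB (n : ℕ) :
    (Polynomial.X : Polynomial (Polynomial ℤ)) ^ n
      = ∑ k ∈ Finset.range (n+1), Polynomial.C (SB n k) *
          ∏ i ∈ Finset.range k, (Polynomial.X - Polynomial.C (qInt (2*i+1))) := by
  induction n with
  | zero => simp [SB]
  | succ n ih =>
    set P : ℕ → Polynomial (Polynomial ℤ) := fun k =>
      ∏ i ∈ Finset.range k, (Polynomial.X - Polynomial.C (qInt (2*i+1))) with hP
    have hPs : ∀ k, P (k+1) = P k * (Polynomial.X - Polynomial.C (qInt (2*k+1))) := by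
      intro k
      simp only [hP, Finset.prod_range_succ]
    change _ = ∑ k ∈ Finset.range (n+1+1), Polynomial.C (SB (n+1) k) * P k
    change _ = ∑ k ∈ Finset.range (n+1), Polynomial.C (SB n k) * P k at ih
    have h2 : ∑ k ∈ Finset.range (n+1+1), Polynomial.C (qInt (2*k+1) * SB n k) * P k
        = ∑ k ∈ Finset.range (n+1), Polynomial.C (qInt (2*k+1) * SB n k) * P k := by
      rw [Finset.sum_range_succ, SB_eq_zero_of_lt n (n+1) (by omega)]
      simp
    rw [Finset.sum_range_succ'] at h2 ⊢
    have h3 : ∀ k, Polynomial.C (SB (n+1) (k+1)) * P (k+1)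
        = Polynomial.C (SB n k) * P (k+1)
          + Polynomial.C (qInt (2*(k+1)+1) * SB n (k+1)) * P (k+1) := by
      intro k
      rw [SB, Polynomial.C_add, add_mul]
    have h4 : SB (n+1) 0 = qInt (2*0+1) * SB n 0 := by rw [SB]
    simp only [h3]
    rw [Finset.sum_add_distrib, h4, add_assoc, h2, ← Finset.sum_add_distrib, pow_succ, ih,
      Finset.sum_mul]
    refine Finset.sum_congr rfl fun k _ => ?_
    rw [hPs, Polynomial.C_mul]
    ring
end

section
/- For all n, k ∈ ℕ, in ℤ[q] one has Σ_{i=0}^{n} s_B[n,i] · S_B[i,k] = δ_{n,k}; that is, the infinite lower-triangular matrices [s_B[n,k]]_{n,k≥0} and [S_B[n,k]]_{n,k≥0} are inverse to each other. -/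
open Polynomial Finset

/-- Signless type B q-Stirling numbers of the first kind. -/
noncomputable def cB : ℕ → ℕ → Polynomial ℤ
  | 0, k => if k = 0 then 1 else 0
  | n+1, 0 => qInt (2*n+1) * cB n 0
  | n+1, k+1 => cB n k + qInt (2*n+1) * cB n (k+1)

/-- Signed type B q-Stirling numbers of the first kind. -/
noncomputable def sB (n k : ℕ) : Polynomial ℤ := (-1)^(n-k) * cB n k

theorem cB_zero_of_lt (n : ℕ) : ∀ k, n < k → cB n k = 0 := by
  induction n with
  | zero => intro k hk; simp [cB]; omega
  | succ n ih =>
    intro k hk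
    cases k with
    | zero => omega
    | succ k => simp [cB, ih k (by omega), ih (k+1) (by omega)]

theorem sB_succ_zero (n : ℕ) : sB (n+1) 0 = - (qInt (2*n+1) * sB n 0) := by
  simp only [sB, cB, Nat.sub_zero, pow_succ]; ring

theorem sB_succ_succ (n i : ℕ) :
    sB (n+1) (i+1) = sB n i - qInt (2*n+1) * sB n (i+1) := by
  simp only [sB, cB, Nat.add_sub_add_right]
  rcases Nat.lt_or_ge n (i+1) with h | h
  · rw [cB_zero_of_lt n (i+1) h]; ring
  · obtain ⟨d, rfl⟩ := Nat.exists_eq_add_of_le h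
    rw [show i + 1 + d - i = d + 1 by omega, show i + 1 + d - (i+1) = d by omega, pow_succ]
    ring

theorem sum_rec (n : ℕ) (g : ℕ → Polynomial ℤ) :
    ∑ i ∈ Finset.range (n+2), sB (n+1) i * g i =
      ∑ i ∈ Finset.range (n+1), sB n i * g (i+1)
        - qInt (2*n+1) * ∑ i ∈ Finset.range (n+1), sB n i * g i := by
  have h0 : sB n (n+1) = 0 := by simp [sB, cB_zero_of_lt n (n+1) (by omega)]
  have h1 : ∑ i ∈ Finset.range (n+1), sB n i * g i
      = ∑ i ∈ Finset.range (n+2), sB n i * g i := by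
    rw [Finset.sum_range_succ _ (n+1), h0]; ring
  rw [h1, Finset.sum_range_succ' _ (n+1), Finset.sum_range_succ' _ (n+1), sB_succ_zero]
  simp only [sB_succ_succ, sub_mul, Finset.sum_sub_distrib, mul_add, Finset.mul_sum, mul_assoc]
  ring

theorem sB_SB_inverse (n k : ℕ) :
    ∑ i ∈ Finset.range (n+1), sB n i * SB i k = if n = k then 1 else 0 := by
  induction n generalizing k with
  | zero => cases k <;> simp [sB, cB, SB]
  | succ n ih =>
    rw [sum_rec]
    cases k with
    | zero =>
      have : ∀ i, sB n i * SB (i+1) 0 = qInt 1 * (sB n i * SB i 0) := by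
        intro i; simp only [SB]; ring
      simp only [this, ← Finset.mul_sum, ih]
      by_cases h : n = 0
      · subst h; simp
      · simp [h]
    | succ k =>
      have : ∀ i, sB n i * SB (i+1) (k+1)
          = sB n i * SB i k + qInt (2*(k+1)+1) * (sB n i * SB i (k+1)) := by
        intro i; simp only [SB]; ring
      simp only [this, Finset.sum_add_distrib, ← Finset.mul_sum, ih]
      by_cases h : n = k + 1
      · subst h; simp
      · simp [h]
end

section
/- For all n, k ∈ ℕ, the number of signed permutations π of {i ∈ ℤ : 1 ≤ |i| ≤ n} (that is, bijections π of this set onto itself satisfying π(−i) = −π(i) for all i) whose number of orbits O with O ≠ −O equals 2k, is exactly c_B(n,k). (Orbits O with O ≠ −O are the paired cycles; they come in pairs O, −O, so their number is even.) -/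
open Finset

/-- Type B Stirling numbers of the first kind (signless). -/
def cBnat : ℕ → ℕ → ℕ
  | 0, k => if k = 0 then 1 else 0
  | n+1, 0 => (2*n+1) * cBnat n 0
  | n+1, k+1 => cBnat n k + (2*n+1) * cBnat n (k+1)

def SgnP (n : ℕ) (π : Equiv.Perm ℤ) : Prop :=
  (∀ i : ℤ, π (-i) = -π i) ∧ (∀ i : ℤ, ¬(1 ≤ |i| ∧ |i| ≤ (n : ℤ)) → π i = i)

def orbP (π : Equiv.Perm ℤ) (i : ℤ) : Set ℤ := Set.range (fun m : ℤ => ((π ^ m) i))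

def baseP (n : ℕ) (π : Equiv.Perm ℤ) : Set ℤ :=
  {i | (1 ≤ |i| ∧ |i| ≤ (n : ℤ)) ∧ ¬ π.SameCycle i (-i)}

def pairP (n : ℕ) (π : Equiv.Perm ℤ) : Set (Set ℤ) := orbP π '' baseP n π

theorem mem_orbP (π : Equiv.Perm ℤ) (i j : ℤ) : j ∈ orbP π i ↔ π.SameCycle i j := Iff.rfl

theorem orbP_eq (π : Equiv.Perm ℤ) (i j : ℤ) : orbP π i = orbP π j ↔ π.SameCycle i j := by
  constructor
  · intro h
    rw [← mem_orbP, h, mem_orbP]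
  · intro h
    ext x
    rw [mem_orbP, mem_orbP]
    exact ⟨fun h' => h.symm.trans h', fun h' => h.trans h'⟩

theorem zpow_neg_apply (π : Equiv.Perm ℤ) (h : ∀ i : ℤ, π (-i) = -π i) (m i : ℤ) :
    (π ^ m) (-i) = -((π ^ m) i) := by
  induction m generalizing i with
  | zero => simp
  | succ m ih => rw [zpow_add_one, Equiv.Perm.mul_apply, Equiv.Perm.mul_apply, h, ih]
  | pred m ih =>
    rw [zpow_sub_one, Equiv.Perm.mul_apply, Equiv.Perm.mul_apply, ← ih]
    congr 1
    rw [Equiv.Perm.inv_eq_iff_eq, h]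
    simp

theorem orbP_neg (π : Equiv.Perm ℤ) (h : ∀ i : ℤ, π (-i) = -π i) (i : ℤ) :
    (fun x : ℤ => -x) '' orbP π i = orbP π (-i) := by
  unfold orbP
  rw [← Set.range_comp]
  congr 1
  funext m
  simp [zpow_neg_apply π h]

theorem pairP_eq (n : ℕ) (π : Equiv.Perm ℤ) (h : ∀ i : ℤ, π (-i) = -π i) :
    {O : Set ℤ | (∃ i : ℤ, (1 ≤ |i| ∧ |i| ≤ (n : ℤ)) ∧
        O = Set.range (fun m : ℤ => ((π ^ m) i))) ∧ (fun x : ℤ => -x) '' O ≠ O} = pairP n π := by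
  ext O
  constructor
  · rintro ⟨⟨i, hi, rfl⟩, hO⟩
    refine ⟨i, ⟨hi, ?_⟩, rfl⟩
    intro hs
    apply hO
    have := orbP_neg π h i
    rw [(orbP_eq π i (-i)).2 hs |>.symm] at this
    exact this
  · rintro ⟨i, ⟨hi, hs⟩, rfl⟩
    refine ⟨⟨i, hi, rfl⟩, ?_⟩
    rw [orbP_neg π h]
    intro h'
    exact hs ((orbP_eq _ _ _).1 h'.symm)

theorem sameCycle_map (π σ : Equiv.Perm ℤ) (r : ℤ → ℤ)
    (hr : ∀ x, σ.SameCycle (r x) (r (π x))) {x y : ℤ} (h : π.SameCycle x y) :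
    σ.SameCycle (r x) (r y) := by
  obtain ⟨m, rfl⟩ := h
  induction m with
  | zero => simpa using Equiv.Perm.SameCycle.refl σ (r x)
  | succ m ih =>
    rw [add_comm, zpow_add, Equiv.Perm.mul_apply, zpow_one]
    exact ih.trans (hr _)
  | pred m ih =>
    refine ih.trans ?_
    have := hr ((π ^ (-(m:ℤ) - 1)) x)
    rw [← Equiv.Perm.mul_apply, ← zpow_one_add] at this
    rw [show 1 + (-(m:ℤ) - 1) = -m by ring] at this
    exact this.symm

theorem encard_image_congr {α β : Type*} (A : Set α) (F G : α → β)
    (h : ∀ x ∈ A, ∀ y ∈ A, F x = F y ↔ G x = G y) : (F '' A).encard = (G '' A).encard := by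
  classical
  have : ∀ s : F '' A, ∃ a ∈ A, F a = s := fun s => s.2
  choose g hgA hgF using this
  let e : F '' A → G '' A := fun s => ⟨G (g s), g s, hgA s, rfl⟩
  have he : Function.Bijective e := by
    constructor
    · intro s t hst
      have h1 : G (g s) = G (g t) := congrArg Subtype.val hst
      apply Subtype.ext
      rw [← hgF s, ← hgF t]
      exact (h _ (hgA s) _ (hgA t)).2 h1
    · rintro ⟨_, a, ha, rfl⟩
      refine ⟨⟨F a, a, ha, rfl⟩, Subtype.ext ?_⟩
      exact (h _ (hgA _) _ ha).1 (hgF _)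
  exact Set.encard_congr (Equiv.ofBijective e he)

/-- signed transposition -/
def tauF (N j x : ℤ) : ℤ :=
  if N = 0 ∨ j = 0 then x else
  if x = N then j else if x = j then N else if x = -N then -j else if x = -j then -N else x

theorem tauF_inv (N j : ℤ) : Function.Involutive (tauF N j) := by
  intro x
  unfold tauF
  grind

def tau (N j : ℤ) : Equiv.Perm ℤ := (tauF_inv N j).toPerm

theorem tau_apply (N j x : ℤ) : tau N j x = tauF N j x := rfl

theorem tau_tau (N j : ℤ) : tau N j * tau N j = 1 := by
  ext x
  exact tauF_inv N j x

theorem tau_self (N : ℤ) : tau N N = 1 := by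
  ext x
  simp only [tau_apply, tauF, Equiv.Perm.one_apply]
  grind

theorem tau_neg (N j x : ℤ) : tau N j (-x) = - tau N j x := by
  simp only [tau_apply, tauF]
  grind

theorem SgnP.lt {n : ℕ} {π : Equiv.Perm ℤ} (h : SgnP n π) {x : ℤ} (hx : |x| ≤ n) :
    |π x| ≤ n := by
  by_contra hc
  have h1 : π (π x) = π x := h.2 _ (by omega)
  have := π.injective h1
  rw [this] at hc
  exact hc hx

theorem SgnP.ne_zero {n : ℕ} {π : Equiv.Perm ℤ} (h : SgnP n π) {x : ℤ} (hx : x ≠ 0) :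
    π x ≠ 0 := by
  intro hc
  have h1 : π 0 = 0 := h.2 _ (by simp)
  exact hx (π.injective (hc.trans h1.symm))

theorem SgnP.mul_tau {n : ℕ} {σ : Equiv.Perm ℤ} (h : SgnP n σ) {j : ℤ}
    (hj : |j| ≤ (n : ℤ) + 1) : SgnP (n+1) (tau (n+1) j * σ) := by
  constructor
  · intro i
    rw [Equiv.Perm.mul_apply, Equiv.Perm.mul_apply, h.1, tau_neg]
  · intro i hi
    push_cast at hi
    rw [Equiv.Perm.mul_apply, h.2 i (by omega), tau_apply]
    simp only [tauF]
    grind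

theorem SgnP.of_succ {n : ℕ} {π : Equiv.Perm ℤ} (h : SgnP (n+1) π) :
    SgnP n (tau (n+1) (π (n+1)) * π) := by
  have h0 : π 0 = 0 := h.2 _ (by simp)
  have hN := h.ne_zero (x := n+1) (by omega)
  have hN' := h.1 (n+1)
  constructor
  · intro i
    rw [Equiv.Perm.mul_apply, Equiv.Perm.mul_apply, h.1, tau_neg]
  · intro i hi
    have hb := h.lt (x := n+1) (by push_cast; rw [abs_of_nonneg] ; omega)
    push_cast at hb
    have h2 := h.2 i
    push_cast at h2
    rw [Equiv.Perm.mul_apply, tau_apply]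
    by_cases h3 : i = n+1
    · subst h3; simp only [tauF]; grind
    by_cases h4 : i = -(n+1)
    · subst h4; rw [hN']; simp only [tauF]; grind
    rw [h2 (by grind)]
    simp only [tauF]
    grind

theorem sameCycle_iff {n : ℕ} {σ : Equiv.Perm ℤ} (h : SgnP n σ) {j : ℤ}
    (hj : |j| ≤ (n : ℤ) + 1) (hj0 : j ≠ 0) {x y : ℤ} (hx : |x| ≤ n) (hy : |y| ≤ n) :
    (tau (n+1) j * σ).SameCycle x y ↔ σ.SameCycle x y := by
  constructor
  · intro hs
    let r : ℤ → ℤ := fun x => if x = n+1 then (if |j| ≤ n then j else 0) else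
      if x = -(n+1) then (if |j| ≤ n then -j else 0) else x
    have hr : ∀ x : ℤ, |x| ≤ n → r x = x := by
      intro x hx
      simp only [r]
      grind
    have := sameCycle_map (tau (n+1) j * σ) σ r ?_ hs
    · rwa [hr x hx, hr y hy] at this
    · intro x
      rw [Equiv.Perm.mul_apply, tau_apply]
      by_cases hx : |x| ≤ n
      · have h1 := h.lt hx
        have : r (tauF (n+1) j (σ x)) = σ x := by
          simp only [r, tauF]
          grind
        rw [this, hr x hx]
        exact ⟨1, by simp⟩
      · rw [h.2 x (by omega)]
        have : r (tauF (n+1) j x) = r x := by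
          clear hr hs
          rcases (show |j| ≤ n ∨ (j = n+1 ∧ ¬ |j| ≤ n) ∨ (j = -(n+1) ∧ ¬ |j| ≤ n) by grind)
            with h3 | ⟨h2, h3⟩ | ⟨h2, h3⟩
          · simp only [r, tauF, h3, if_true]
            grind
          · simp only [r, tauF, h3, if_false]
            grind
          · simp only [r, tauF, h3, if_false]
            grind
        rw [this]
  · intro hs
    refine sameCycle_map σ (tau (n+1) j * σ) id ?_ hs
    intro x
    simp only [id]
    by_cases hx : |x| ≤ n
    · have h1 := h.lt hx
      have hN : σ (n+1) = n+1 := h.2 _ (by grind)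
      have hN' : σ (-(n+1)) = -(n+1) := h.2 _ (by grind)
      by_cases h2 : σ x = j
      · refine ⟨2, ?_⟩
        rw [zpow_ofNat, pow_two]
        simp only [Equiv.Perm.mul_apply, tau_apply, h2]
        rw [show tauF (n+1) j j = n+1 by simp only [tauF]; grind, hN]
        simp only [tauF]; grind
      by_cases h3 : σ x = -j
      · refine ⟨2, ?_⟩
        rw [zpow_ofNat, pow_two]
        simp only [Equiv.Perm.mul_apply, tau_apply, h3]
        rw [show tauF (n+1) j (-j) = -(n+1) by simp only [tauF]; grind, hN']
        simp only [tauF]; grind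
      · refine ⟨1, ?_⟩
        rw [zpow_one]
        simp only [Equiv.Perm.mul_apply, tau_apply, tauF]; grind
    · rw [h.2 x (by omega)]

theorem pairP_tau_encard {n : ℕ} {σ : Equiv.Perm ℤ} (h : SgnP n σ) {j : ℤ}
    (hj : |j| ≤ (n : ℤ) + 1) (hj0 : j ≠ 0) :
    (pairP n (tau (n+1) j * σ)).encard = (pairP n σ).encard := by
  have hb : baseP n (tau (n+1) j * σ) = baseP n σ := by
    ext i
    simp only [baseP, Set.mem_ofPred_eq]
    refine and_congr_right fun hi => ?_
    rw [sameCycle_iff h hj hj0 hi.2 (by rw [abs_neg]; exact hi.2)]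
  unfold pairP
  rw [hb]
  apply encard_image_congr
  intro x hx y hy
  rw [orbP_eq, orbP_eq, sameCycle_iff h hj hj0 hx.1.2 hy.1.2]

theorem pairP_succ {n : ℕ} {σ : Equiv.Perm ℤ} (h : SgnP n σ) {j : ℤ}
    (hj : |j| ≤ (n : ℤ) + 1) (hj0 : j ≠ 0) (hjN : j ≠ n+1) :
    pairP (n+1) (tau (n+1) j * σ) = pairP n (tau (n+1) j * σ) := by
  have hs := h.mul_tau hj
  set π := tau (n+1) j * σ with hπ
  have hN : π (n+1) = j := by
    rw [hπ, Equiv.Perm.mul_apply, h.2 _ (by grind), tau_apply]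
    simp only [tauF]; grind
  have hN' : π (-(n+1)) = -j := by rw [hs.1, hN]
  have c1 : π.SameCycle (n+1) j := ⟨1, by simpa using hN⟩
  have c2 : π.SameCycle (-(n+1)) (-j) := ⟨1, by simpa using hN'⟩
  apply Set.Subset.antisymm
  · rintro _ ⟨i, ⟨hi, hni⟩, rfl⟩
    push_cast at hi
    by_cases hin : |i| ≤ n
    · exact ⟨i, ⟨⟨hi.1, hin⟩, hni⟩, rfl⟩
    · have : i = n+1 ∨ i = -(n+1) := by grind
      rcases this with rfl | rfl
      · have hjn : j ≠ -(n+1) := by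
          intro h'; exact hni (by rw [← h']; exact c1)
        refine ⟨j, ⟨by grind, ?_⟩, ((orbP_eq _ _ _).2 c1).symm⟩
        intro hh
        exact hni (c1.trans (hh.trans c2.symm))
      · have hjn : j ≠ -(n+1) := by
          intro h'; apply hni
          rw [neg_neg, ← h']; exact c1.symm
        refine ⟨-j, ⟨by grind, ?_⟩, ((orbP_eq _ _ _).2 c2).symm⟩
        intro hh
        rw [neg_neg] at hh
        apply hni
        rw [neg_neg]
        exact (c2.trans (hh.trans c1.symm))
  · rintro _ ⟨i, ⟨hi, hni⟩, rfl⟩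
    exact ⟨i, ⟨by push_cast; omega, hni⟩, rfl⟩

theorem sameCycle_fix {σ : Equiv.Perm ℤ} {x y : ℤ} (hx : σ x = x) (h : σ.SameCycle x y) :
    x = y := Equiv.Perm.SameCycle.eq_of_left h hx

theorem pairP_fix {n : ℕ} {σ : Equiv.Perm ℤ} (h : SgnP n σ) :
    (pairP (n+1) σ).encard = (pairP n σ).encard + 2 := by
  have hN : σ (n+1) = n+1 := h.2 _ (by grind)
  have hN' : σ (-(n+1)) = -(n+1) := h.2 _ (by grind)
  have hb : baseP (n+1) σ = baseP n σ ∪ {(n+1 : ℤ), -(n+1 : ℤ)} := by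
    ext i
    simp only [baseP, Set.mem_ofPred_eq, Set.mem_union, Set.mem_insert_iff, Set.mem_singleton_iff]
    push_cast
    constructor
    · rintro ⟨hi, hs⟩
      by_cases hin : |i| ≤ n
      · exact Or.inl ⟨⟨hi.1, hin⟩, hs⟩
      · right; grind
    · rintro (⟨hi, hs⟩ | rfl | rfl)
      · exact ⟨by omega, hs⟩
      · refine ⟨by grind, fun hs => ?_⟩
        have := sameCycle_fix hN hs
        omega
      · refine ⟨by grind, fun hs => ?_⟩
        have := sameCycle_fix hN' hs
        omega
  have hp : pairP (n+1) σ = pairP n σ ∪ {orbP σ (n+1), orbP σ (-(n+1))} := by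
    unfold pairP
    rw [hb, Set.image_union, Set.image_pair]
  rw [hp, Set.encard_union_eq, Set.encard_pair]
  · intro he
    have := sameCycle_fix hN ((orbP_eq _ _ _).1 he)
    omega
  · rw [Set.disjoint_left]
    rintro _ ⟨i, ⟨hi, hni⟩, rfl⟩ hm
    rcases hm with hm | hm
    · have := sameCycle_fix hN ((orbP_eq _ _ _).1 hm.symm)
      grind
    · have := sameCycle_fix hN' ((orbP_eq _ _ _).1 hm.symm)
      grind

def TP (n k : ℕ) : Set (Equiv.Perm ℤ) := {π | SgnP n π ∧ (pairP n π).encard = 2 * k}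

def JP (n : ℕ) : Set ℤ := {j | |j| ≤ (n : ℤ) + 1 ∧ j ≠ 0 ∧ j ≠ n + 1}

theorem JP_card (n : ℕ) : (JP n).encard = 2 * n + 1 := by
  have : JP n = (((Finset.Icc (-(n+1) : ℤ) n).erase 0 : Finset ℤ) : Set ℤ) := by
    ext j
    simp only [JP, Set.mem_ofPred_eq, Finset.coe_erase, Finset.coe_Icc, Set.mem_sdiff, Set.mem_Icc,
      Set.mem_singleton_iff]
    grind
  rw [this, Set.encard_coe_eq_coe_finsetCard, Finset.card_erase_of_mem (by simp), Int.card_Icc]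
  have : ((n:ℤ) + 1 - -(n+1)).toNat - 1 = 2 * n + 1 := by omega
  rw [this]; push_cast; rfl

def mP (n : ℕ) (p : ℤ × Equiv.Perm ℤ) : Equiv.Perm ℤ := tau (n+1) p.1 * p.2

theorem mP_N {n : ℕ} {σ : Equiv.Perm ℤ} (h : SgnP n σ) {j : ℤ} (hj0 : j ≠ 0) :
    (tau (n+1) j * σ) (n+1) = j := by
  rw [Equiv.Perm.mul_apply, h.2 _ (by grind), tau_apply]
  simp only [tauF]; grind

theorem TP_split (n k : ℕ) :
    TP (n+1) k = mP n '' (JP n ×ˢ TP n k) ∪ {σ | SgnP n σ ∧ (pairP n σ).encard + 2 = 2 * k} := by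
  ext π
  constructor
  · rintro ⟨h, hc⟩
    have hσ := h.of_succ
    have hb := h.lt (x := n+1) (by push_cast; rw [abs_of_nonneg] ; omega)
    push_cast at hb
    have h0 := h.ne_zero (x := n+1) (by omega)
    have he : tau (n+1) (π (n+1)) * (tau (n+1) (π (n+1)) * π) = π := by
      rw [← mul_assoc, tau_tau, one_mul]
    by_cases hN : π (n+1) = n+1
    · right
      rw [hN, tau_self, one_mul] at hσ
      exact ⟨hσ, by rw [← pairP_fix hσ, hc]⟩
    · left
      refine ⟨(π (n+1), tau (n+1) (π (n+1)) * π), ⟨⟨hb, h0, hN⟩, hσ, ?_⟩, he⟩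
      rw [← pairP_tau_encard hσ hb h0, ← pairP_succ hσ hb h0 hN, he, hc]
  · rintro (⟨⟨j, σ⟩, ⟨⟨hb, h0, hN⟩, hσ, hc⟩, rfl⟩ | ⟨h, hc⟩)
    · refine ⟨hσ.mul_tau hb, ?_⟩
      simp only [mP]
      rw [pairP_succ hσ hb h0 hN, pairP_tau_encard hσ hb h0]
      exact hc
    · refine ⟨⟨h.1, fun i hi => h.2 i ?_⟩, by rw [pairP_fix h, hc]⟩
      push_cast at hi
      omega

theorem TP_rec (n k : ℕ) : (TP (n+1) k).encard = (2 * n + 1) * (TP n k).encard +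
    {σ | SgnP n σ ∧ (pairP n σ).encard + 2 = 2 * k}.encard := by
  rw [TP_split, Set.encard_union_eq, Set.InjOn.encard_image, Set.encard_prod, JP_card]
  · rintro ⟨j, σ⟩ ⟨⟨hb, h0, hN⟩, hσ, hc⟩ ⟨j', σ'⟩ ⟨⟨hb', h0', hN'⟩, hσ', hc'⟩ he
    simp only [mP] at he
    have : j = j' := by
      dsimp only at *
      rw [← mP_N hσ h0, he, mP_N hσ' h0']
    subst this
    rw [mul_left_cancel he]
  · rw [Set.disjoint_left]
    rintro _ ⟨⟨j, σ⟩, ⟨⟨hb, h0, hN⟩, hσ, hc⟩, rfl⟩ ⟨h, -⟩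
    apply hN
    have h1 := mP_N hσ h0
    have h2 := h.2 (n+1) (by grind)
    exact h1.symm.trans h2

theorem pairP_finite (n : ℕ) (π : Equiv.Perm ℤ) : (pairP n π).Finite := by
  apply Set.Finite.image
  apply (Set.finite_Icc (-(n:ℤ)) n).subset
  rintro i ⟨hi, -⟩
  exact abs_le.1 hi.2

theorem TP_card (n k : ℕ) : (TP n k).encard = cBnat n k := by
  induction n generalizing k with
  | zero =>
    have hp : ∀ π, pairP 0 π = ∅ := by
      intro π
      have : baseP 0 π = ∅ := by
        ext i
        simp only [baseP, Set.mem_ofPred_eq, Set.mem_empty_iff_false, iff_false]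
        push_cast
        omega
      rw [pairP, this, Set.image_empty]
    by_cases hk : k = 0
    · subst hk
      have : TP 0 0 = {1} := by
        ext π
        simp only [TP, hp, Set.mem_ofPred_eq, Set.mem_singleton_iff]
        constructor
        · rintro ⟨h, -⟩
          ext i
          exact h.2 i (by push_cast; omega)
        · rintro rfl
          simp [SgnP]
      rw [this]
      simp [cBnat]
    · have : TP 0 k = ∅ := by
        ext π
        simp [TP, hp, hk, eq_comm]
      rw [this]
      simp [cBnat, hk]
  | succ n ih =>
    rw [TP_rec, ih]
    cases k with
    | zero =>
      have : {σ | SgnP n σ ∧ (pairP n σ).encard + 2 = 2 * (0:ℕ)} = ∅ := by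
        ext σ
        simp
      rw [this]
      simp [cBnat]
    | succ k =>
      have : {σ | SgnP n σ ∧ (pairP n σ).encard + 2 = 2 * ((k+1 : ℕ) : ℕ∞)} = TP n k := by
        ext σ
        simp only [TP, Set.mem_ofPred_eq]
        refine and_congr_right fun _ => ?_
        rw [← (pairP_finite n σ).cast_ncard_eq]
        norm_cast
        omega
      rw [this, ih]
      simp only [cBnat]
      push_cast
      ring

/-- The number of signed permutations of {i : 1 ≤ |i| ≤ n} (encoded as permutations of ℤ
fixing everything outside that set, and satisfying π(-i) = -π(i)) having exactly 2k
orbits O with O ≠ -O is c_B(n,k). -/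
theorem card_signed_perms_with_paired_cycles (n k : ℕ) :
    Set.ncard {π : Equiv.Perm ℤ |
        (∀ i : ℤ, π (-i) = -π i) ∧
        (∀ i : ℤ, ¬(1 ≤ |i| ∧ |i| ≤ (n : ℤ)) → π i = i) ∧
        Set.ncard {O : Set ℤ |
            (∃ i : ℤ, (1 ≤ |i| ∧ |i| ≤ (n : ℤ)) ∧
              O = Set.range (fun m : ℤ => ((π ^ m) i))) ∧
            (fun x : ℤ => -x) '' O ≠ O} = 2 * k}
      = cBnat n k := by
  rw [Set.ncard_def]
  have : {π : Equiv.Perm ℤ |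
        (∀ i : ℤ, π (-i) = -π i) ∧
        (∀ i : ℤ, ¬(1 ≤ |i| ∧ |i| ≤ (n : ℤ)) → π i = i) ∧
        Set.ncard {O : Set ℤ |
            (∃ i : ℤ, (1 ≤ |i| ∧ |i| ≤ (n : ℤ)) ∧
              O = Set.range (fun m : ℤ => ((π ^ m) i))) ∧
            (fun x : ℤ => -x) '' O ≠ O} = 2 * k} = TP n k := by
    ext π
    simp only [TP, SgnP, Set.mem_ofPred_eq]
    rw [and_assoc]
    refine and_congr_right fun h => and_congr_right fun _ => ?_
    rw [pairP_eq n π h, ← (pairP_finite n π).cast_ncard_eq]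
    norm_cast
  rw [this, TP_card]
  simp
end

section
/- For all n, k ∈ ℕ, in the field ℚ(q) of rational functions one has q^{C(k,2)} · S^o[n,k] = Σ_{i=0}^k (−1)^{k−i} q^{C(k−i,2)} · ([k]_q!/([i]_q! · [k−i]_q!)) · ([i]_q)^n, where C(j,2) = j(j−1)/2 and [k]_q!/([i]_q![k−i]_q!) is the Gaussian binomial coefficient. (This is the coefficient of x^n/[n]_q! in the identity Σ_{n≥0} S^o[n,k] x^n/[n]_q! = q^{−C(k,2)} Σ_{i=0}^k (−1)^{k−i} q^{C(k−i,2)} [k choose i]_q exp_q([i]_q x).) -/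
open Finset

/-- The q-integer [m]_q = 1 + q + ... + q^(m-1) in ℚ(q). -/
noncomputable def rq (m : ℕ) : RatFunc ℚ := ∑ i ∈ Finset.range m, RatFunc.X ^ i

/-- The q-factorial [m]_q! in ℚ(q). -/
noncomputable def rqFact (m : ℕ) : RatFunc ℚ := ∏ i ∈ Finset.range m, rq (i+1)

/-- Type A q-Stirling numbers of the second kind, in ℚ(q). -/
noncomputable def SAr : ℕ → ℕ → RatFunc ℚ
  | 0, k => if k = 0 then 1 else 0
  | _+1, 0 => 0
  | n+1, k+1 => SAr n k + rq (k+1) * SAr n (k+1)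

theorem aux_rq_ne (m : ℕ) : rq (m+1) ≠ 0 := by
  have h : rq (m+1) = algebraMap (Polynomial ℚ) (RatFunc ℚ) (∑ i ∈ Finset.range (m+1), Polynomial.X ^ i) := by
    simp [rq, map_sum, RatFunc.algebraMap_X]
  rw [h]
  intro h0
  have h1 := (map_eq_zero_iff _ (RatFunc.algebraMap_injective ℚ)).1 h0
  have h2 := congrArg (Polynomial.eval 1) h1
  simp [Polynomial.eval_finsetSum] at h2
  have : (m:ℚ) + 1 ≠ 0 := by positivity
  exact this h2

theorem aux_fact_ne (m : ℕ) : rqFact m ≠ 0 :=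
  Finset.prod_ne_zero_iff.2 (fun i _ => aux_rq_ne i)

theorem aux_fact_succ (m : ℕ) : rqFact (m+1) = rqFact m * rq (m+1) := by
  simp [rqFact, Finset.prod_range_succ]

theorem aux_rq_add (a b : ℕ) : rq (a+b) = rq a + RatFunc.X ^ a * rq b := by
  simp [rq, Finset.sum_range_add, pow_add, Finset.mul_sum]

/-- summand -/
noncomputable def auxC (k i : ℕ) : RatFunc ℚ :=
  (-1 : RatFunc ℚ)^(k-i) * RatFunc.X ^ ((k-i).choose 2) / (rqFact i * rqFact (k-i))

noncomputable def auxT (n k : ℕ) : RatFunc ℚ :=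
  ∑ i ∈ Finset.range (k+1), auxC k i * (rq i)^n

theorem auxC_left (k i : ℕ) (hi : i ≤ k) :
    RatFunc.X ^ i * rq (k+1-i) * auxC (k+1) i = - (RatFunc.X ^ k * auxC k i) := by
  obtain ⟨j, rfl⟩ := Nat.exists_eq_add_of_le hi
  have e1 : i + j + 1 - i = j + 1 := by omega
  have e2 : i + j - i = j := by omega
  have e3 : (j+1).choose 2 = j + j.choose 2 := by
    rw [Nat.choose_succ_succ' j 1, Nat.choose_one_right]
  simp only [auxC, e1, e2, e3, aux_fact_succ]
  have h1 := aux_fact_ne i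
  have h2 := aux_fact_ne j
  have h3 := aux_rq_ne j
  field_simp
  ring

theorem auxC_right (k i : ℕ) :
    rq (i+1) * auxC (k+1) (i+1) = auxC k i := by
  simp only [auxC, Nat.add_sub_add_right, aux_fact_succ]
  have h1 := aux_fact_ne i
  have h2 := aux_fact_ne (k-i)
  have h3 := aux_rq_ne i
  field_simp

theorem auxT_rec (n k : ℕ) :
    auxT (n+1) (k+1) = rq (k+1) * auxT n (k+1) + RatFunc.X ^ k * auxT n k := by
  have h : rq (k+1) * auxT n (k+1) - auxT (n+1) (k+1) = - (RatFunc.X ^ k * auxT n k) := by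
    unfold auxT
    rw [Finset.sum_range_succ _ (k+1), Finset.sum_range_succ _ (k+1), mul_add, Finset.mul_sum]
    have : ∀ a b c d : RatFunc ℚ, b = d → a + b - (c + d) = a - c := by
      intro a b c d h; rw [h]; ring
    rw [this _ _ _ _ (by ring), ← Finset.sum_sub_distrib, Finset.mul_sum, ← Finset.sum_neg_distrib]
    refine Finset.sum_congr rfl fun i hi => ?_
    have hi' : i ≤ k := by have := Finset.mem_range.1 hi; omega
    have h1 := auxC_left k i hi'
    have h2 := aux_rq_add i (k+1-i)
    rw [show i + (k+1-i) = k+1 by omega] at h2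
    rw [h2]
    linear_combination (rq i)^n * h1
  linear_combination -h

theorem aux_rq_zero : rq 0 = 0 := by simp [rq]

theorem auxT_one (k : ℕ) : auxT 1 (k+1) = auxT 0 k := by
  unfold auxT
  rw [Finset.sum_range_succ']
  simp only [aux_rq_zero, pow_one, mul_zero, add_zero, pow_zero, mul_one]
  refine Finset.sum_congr rfl fun i _ => ?_
  rw [mul_comm, auxC_right]

theorem auxT_zero (k : ℕ) : auxT 0 (k+1) = 0 := by
  induction k with
  | zero =>
    have h := auxT_rec 0 0
    rw [auxT_one] at h
    have h3 := aux_rq_ne 0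
    refine (mul_eq_zero.1 ?_).resolve_left h3
    linear_combination -h
  | succ k ih =>
    have h := auxT_rec 0 (k+1)
    rw [auxT_one, ih] at h
    have h3 := aux_rq_ne (k+1)
    refine (mul_eq_zero.1 ?_).resolve_left h3
    linear_combination -h

theorem aux_main (n k : ℕ) : RatFunc.X ^ (k.choose 2) * SAr n k = auxT n k := by
  induction n generalizing k with
  | zero =>
    cases k with
    | zero => simp [SAr, auxT, auxC, rqFact]
    | succ k => simp [SAr, auxT_zero]
  | succ n ih =>
    cases k with
    | zero => simp [SAr, auxT, aux_rq_zero]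
    | succ k =>
      rw [auxT_rec, ← ih, ← ih, SAr, Nat.choose_succ_succ' k 1, Nat.choose_one_right]
      ring

/-- Coefficientwise form of the q-exponential generating function for the ordered
q-Stirling numbers Sᵒ[n,k] = [k]! S[n,k]. -/
theorem So_qegf_coeff (n k : ℕ) :
    RatFunc.X ^ (k.choose 2) * (rqFact k * SAr n k)
      = ∑ i ∈ Finset.range (k+1), (-1 : RatFunc ℚ)^(k-i) * RatFunc.X ^ ((k-i).choose 2) *
          (rqFact k / (rqFact i * rqFact (k-i))) * (rq i)^n := by
  have h := aux_main n k
  rw [mul_left_comm, h, auxT, Finset.mul_sum]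
  refine Finset.sum_congr rfl fun i _ => ?_
  unfold auxC
  ring
end

section
/- For every n ∈ ℕ, in ℤ[q] one has Σ_{k=0}^n (−q)^{n−k} · S^o[n,k] = 1. -/
open Polynomial Finset

/-- The q-factorial [m]_q! in ℤ[q]. -/
noncomputable def qFact (m : ℕ) : Polynomial ℤ := ∏ i ∈ Finset.range m, qInt (i+1)

/-- Type A q-Stirling numbers of the second kind. -/
noncomputable def SA : ℕ → ℕ → Polynomial ℤ
  | 0, k => if k = 0 then 1 else 0
  | _+1, 0 => 0
  | n+1, k+1 => SA n k + qInt (k+1) * SA n (k+1)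

theorem SA_gt : ∀ (n k : ℕ), n < k → SA n k = 0
  | 0, k, h => by
    have : k ≠ 0 := by omega
    simp [SA, this]
  | n+1, 0, h => by omega
  | n+1, k+1, h => by
    rw [SA, SA_gt n k (by omega), SA_gt n (k+1) (by omega)]
    simp

theorem qInt_succ' (k : ℕ) : qInt (k+1) = 1 + X * qInt k := by
  unfold qInt
  rw [Finset.sum_range_succ', Finset.mul_sum, add_comm]
  simp [pow_succ']

theorem qFact_succ' (k : ℕ) : qFact (k+1) = qFact k * qInt (k+1) := by
  unfold qFact
  rw [Finset.prod_range_succ]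

theorem So_alternating_sum (n : ℕ) :
    ∑ k ∈ Finset.range (n+1), (-Polynomial.X : Polynomial ℤ)^(n-k) * (qFact k * SA n k)
      = 1 := by
  induction n with
  | zero => simp [SA, qFact]
  | succ n ih =>
    have key : ∑ k ∈ Finset.range (n+1),
        (-X : Polynomial ℤ)^(n+1-(k+1)) * (qInt (k+1) * (qFact (k+1) * SA n (k+1)))
        = ∑ k ∈ Finset.range (n+1),
          (-X : Polynomial ℤ)^(n+1-k) * (qInt k * (qFact k * SA n k)) := by
      have h1 := Finset.sum_range_succ
        (fun k => (-X : Polynomial ℤ)^(n+1-k) * (qInt k * (qFact k * SA n k))) (n+1)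
      rw [Finset.sum_range_succ'] at h1
      have h0 : qInt 0 = 0 := by simp [qInt]
      simpa [h0, SA_gt n (n+1) (by omega)] using h1
    rw [Finset.sum_range_succ']
    have hz : SA (n+1) 0 = 0 := by rw [SA]
    rw [hz, mul_zero, mul_zero, add_zero, ← ih]
    have h2 : ∀ k ∈ Finset.range (n+1),
        (-X : Polynomial ℤ)^(n+1-(k+1)) * (qFact (k+1) * SA (n+1) (k+1))
        = (-X : Polynomial ℤ)^(n-k) * (qInt (k+1) * (qFact k * SA n k))
          + (-X : Polynomial ℤ)^(n+1-(k+1)) * (qInt (k+1) * (qFact (k+1) * SA n (k+1))) := by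
      intro k _
      rw [SA, qFact_succ', Nat.add_sub_add_right]
      ring
    rw [Finset.sum_congr rfl h2, Finset.sum_add_distrib, key, ← Finset.sum_add_distrib]
    refine Finset.sum_congr rfl fun k hk => ?_
    have hk' : k ≤ n := by
      have := Finset.mem_range.1 hk
      omega
    rw [Nat.succ_sub hk', pow_succ, qInt_succ']
    ring
end

section
/- For every fixed n ∈ ℕ, the sequences (S_B[n,k])_{k≥0} and (c_B[n,k])_{k≥0} are strongly q-log-concave: for all k, l ∈ ℕ with 1 ≤ k ≤ l, every coefficient of the polynomial S_B[n,k] · S_B[n,l] − S_B[n,k−1] · S_B[n,l+1] is a nonnegative integer, and likewise every coefficient of c_B[n,k] · c_B[n,l] − c_B[n,k−1] · c_B[n,l+1] is a nonnegative integer. -/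
open Polynomial Finset

def PNN (p : Polynomial ℤ) : Prop := ∀ d, 0 ≤ p.coeff d

theorem PNN.add {p q : Polynomial ℤ} (hp : PNN p) (hq : PNN q) : PNN (p + q) := by
  intro d; rw [Polynomial.coeff_add]; exact add_nonneg (hp d) (hq d)

theorem PNN.mul {p q : Polynomial ℤ} (hp : PNN p) (hq : PNN q) : PNN (p * q) := by
  intro d; rw [Polynomial.coeff_mul]
  exact Finset.sum_nonneg fun i _ => mul_nonneg (hp _) (hq _)

theorem PNN.zero : PNN 0 := by intro d; simp

theorem PNN.one : PNN 1 := by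
  intro d; rw [Polynomial.coeff_one]; split_ifs <;> simp

theorem PNN.xpow (s : ℕ) : PNN (X ^ s) := by
  intro d; rw [Polynomial.coeff_X_pow]; split_ifs <;> simp

theorem PNN.qInt (m : ℕ) : PNN (qInt m) := by
  intro d
  rw [_root_.qInt, Polynomial.finsetSum_coeff]
  exact Finset.sum_nonneg fun i _ => PNN.xpow i d

theorem qInt_add (a b : ℕ) : qInt (a + b) = qInt a + X ^ a * qInt b := by
  simp only [qInt, Finset.sum_range_add, Finset.mul_sum, pow_add]

theorem SB_PNN (n : ℕ) : ∀ k, PNN (SB n k) := by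
  induction n with
  | zero => intro k; rw [SB]; split_ifs; exacts [PNN.one, PNN.zero]
  | succ n ih =>
    intro k
    cases k with
    | zero => rw [SB]; exact (PNN.qInt _).mul (ih _)
    | succ k => rw [SB]; exact (ih _).add ((PNN.qInt _).mul (ih _))

theorem cB_PNN (n : ℕ) : ∀ k, PNN (cB n k) := by
  induction n with
  | zero => intro k; rw [cB]; split_ifs; exacts [PNN.one, PNN.zero]
  | succ n ih =>
    intro k
    cases k with
    | zero => rw [cB]; exact (PNN.qInt _).mul (ih _)
    | succ k => rw [cB]; exact (ih _).add ((PNN.qInt _).mul (ih _))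

/-- shift by one, padded by zero -/
noncomputable def shf (f : ℕ → Polynomial ℤ) : ℕ → Polynomial ℤ
  | 0 => 0
  | k+1 => f k

theorem shf_PNN {f : ℕ → Polynomial ℤ} (h : ∀ k, PNN (f k)) : ∀ k, PNN (shf f k)
  | 0 => PNN.zero
  | k+1 => h k

theorem shf_SB (n k : ℕ) :
    shf (SB (n+1)) (k+1) = shf (SB n) k + qInt (2*k+1) * shf (SB n) (k+1) := by
  cases k <;> simp [shf, SB]

theorem shf_cB (n k : ℕ) :
    shf (cB (n+1)) (k+1) = shf (cB n) k + qInt (2*n+1) * shf (cB n) (k+1) := by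
  cases k <;> simp [shf, cB]

theorem cB_key (n : ℕ) : ∀ j d,
    PNN (shf (cB n) (j+1) * shf (cB n) (j+1+d) - shf (cB n) j * shf (cB n) (j+1+d+1)) := by
  have hT : ∀ n k, PNN (shf (cB n) k) := fun n => shf_PNN (cB_PNN n)
  induction n with
  | zero =>
    intro j d
    have : shf (cB 0) (j+1+d+1) = 0 := by
      have : j + 1 + d ≠ 0 := by omega
      simp [shf, cB]
    rw [this, mul_zero, sub_zero]
    exact (hT _ _).mul (hT _ _)
  | succ n ih =>
    intro j d
    cases j with
    | zero =>
      have : shf (cB (n+1)) 0 = 0 := rfl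
      rw [this, zero_mul, sub_zero]
      exact (hT _ _).mul (hT _ _)
    | succ j =>
      have e : j + 1 + 1 + d = (j + 1 + d) + 1 := by omega
      rw [e]
      simp only [shf_cB]
      have h1 := ih j d
      have h2 := ih (j+1) d
      rw [e] at h2
      have h3 := ih j (d+1)
      rw [← add_assoc] at h3
      have h4 : PNN (shf (cB n) (j+1+1) * shf (cB n) (j+1+d)
          - shf (cB n) (j+1) * shf (cB n) (j+1+d+1)) := by
        cases d with
        | zero => rw [add_zero, mul_comm, sub_self]; exact PNN.zero
        | succ d =>
          have := ih (j+1) d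
          have e : j + 1 + 1 + d = j + 1 + (d + 1) := by omega
          rwa [e] at this
      have ha := PNN.qInt (2*n+1)
      have := (h1.add ((ha.mul ha).mul h2)).add (ha.mul (h3.add h4))
      convert this using 1
      ring

theorem SB_key (n : ℕ) : ∀ j d s, s ≤ 2 * (d + 1) →
    PNN (shf (SB n) (j+1) * shf (SB n) (j+1+d)
      - X ^ s * (shf (SB n) j * shf (SB n) (j+1+d+1))) := by
  have hT : ∀ n k, PNN (shf (SB n) k) := fun n => shf_PNN (SB_PNN n)
  induction n with
  | zero =>
    intro j d s _
    have : shf (SB 0) (j+1+d+1) = 0 := by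
      have : j + 1 + d ≠ 0 := by omega
      simp [shf, SB]
    rw [this, mul_zero, mul_zero, sub_zero]
    exact (hT _ _).mul (hT _ _)
  | succ n ih =>
    intro j d s hs
    cases j with
    | zero =>
      have : shf (SB (n+1)) 0 = 0 := rfl
      rw [this, zero_mul, mul_zero, sub_zero]
      exact (hT _ _).mul (hT _ _)
    | succ j =>
      have e : j + 1 + 1 + d = (j + 1 + d) + 1 := by omega
      rw [e]
      simp only [shf_SB]
      have h1 := ih j d s hs
      have h2 := ih (j+1) d s hs
      rw [e] at h2
      have h3 := ih j (d+1) s (by omega)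
      have h3' := ih j (d+1) (s+2) (by omega)
      rw [← add_assoc] at h3 h3'
      have h4 : PNN (shf (SB n) (j+1+1) * shf (SB n) (j+1+d)
          - X ^ (2*s) * (shf (SB n) j * shf (SB n) (j+1+d+1+1))) := by
        cases d with
        | zero =>
          have := ih j 1 (2*s) (by omega)
          rw [mul_comm (shf (SB n) (j+1+1))]
          exact this
        | succ d =>
          have g1 := ih (j+1) d (s-2) (by omega)
          have e : j + 1 + 1 + d = j + 1 + (d + 1) := by omega
          rw [e] at g1
          have g2 := ih j (d+1+1) (2*s-(s-2)) (by omega)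
          rw [← add_assoc] at g2
          have := g1.add ((PNN.xpow (s-2)).mul g2)
          convert this using 1
          have e2 : (X : Polynomial ℤ) ^ (2*s) = X ^ (s-2) * X ^ (2*s-(s-2)) := by
            rw [← pow_add]; congr 1; omega
          rw [e2]; ring
      obtain ⟨r, hr⟩ : ∃ r, 2 * (d + 1) = s + r := ⟨2*(d+1)-s, by omega⟩
      -- the two q-integer decompositions
      have q1 : qInt (2*(j+1+d)+1) = qInt s + X ^ s * qInt (2*j+1)
          + X ^ s * X ^ (2*j+1) * qInt r := by
        have : 2*(j+1+d)+1 = s + (2*j+1) + r := by omega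
        rw [this, qInt_add, qInt_add, pow_add]
      have q2 : qInt (2*(j+1+d+1)+1) = qInt s + X ^ s * qInt (2*(j+1)+1)
          + X ^ s * X ^ (2*j+1) * X ^ 2 * qInt r := by
        have : 2*(j+1+d+1)+1 = s + (2*(j+1)+1) + r := by omega
        rw [this, qInt_add, qInt_add]
        ring
      have q3 : PNN (qInt (2*(j+1)+1) * qInt (2*(j+1+d)+1)
          - qInt (2*j+1) * qInt (2*(j+1+d+1)+1)) := by
        have a1 : qInt (2*(j+1)+1) = qInt (2*j+1) + X ^ (2*j+1) * qInt 2 := by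
          rw [← qInt_add]; congr 1
        have a2 : qInt (2*(j+1+d+1)+1) = qInt (2*(j+1+d)+1) + X ^ (2*(j+1+d)+1) * qInt 2 := by
          rw [← qInt_add]; congr 1
        have a3 : 2*(j+1+d)+1 = 2*(d+1) + (2*j+1) := by omega
        have a4 : qInt (2*(j+1+d)+1) = qInt (2*(d+1)) + X ^ (2*(d+1)) * qInt (2*j+1) := by
          rw [← qInt_add, ← a3]
        have a5 : (X : Polynomial ℤ) ^ (2*(j+1+d)+1) = X ^ (2*(d+1)) * X ^ (2*j+1) := by
          rw [← pow_add, ← a3]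
        have := ((PNN.qInt 2).mul (PNN.xpow (2*j+1))).mul (PNN.qInt (2*(d+1)))
        convert this using 1
        rw [a1, a2, a5, a4]; ring
      have hak := PNN.qInt (2*(j+1)+1)
      have hal := PNN.qInt (2*(j+1+d)+1)
      have hR := ((PNN.xpow s).mul (PNN.xpow (2*j+1))).mul (PNN.qInt r)
      have := ((((h1.add ((hak.mul hal).mul h2)).add
        (((PNN.xpow s).mul q3).mul ((hT n (j+1)).mul (hT n (j+1+d+1+1))))).add
        ((PNN.qInt s).mul h3)).add (hak.mul h4)).add (hR.mul h3')
      convert this using 1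
      have e5 : (X : Polynomial ℤ) ^ (2*s) = X ^ s * X ^ s := by rw [← pow_add, two_mul]
      have e6 : (X : Polynomial ℤ) ^ (s+2) = X ^ s * X ^ 2 := pow_add _ _ _
      rw [e5, e6]
      linear_combination (shf (SB n) (j+1) * shf (SB n) (j+1+d+1)) * q1
        - X ^ s * (shf (SB n) j * shf (SB n) (j+1+d+1+1)) * q2

/-- For fixed n, the sequences (S_B[n,k])ₖ and (c_B[n,k])ₖ are strongly q-log-concave. -/
theorem SB_cB_strongly_q_log_concave (n k l : ℕ) (hk : 1 ≤ k) (hkl : k ≤ l) (d : ℕ) :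
    0 ≤ (SB n k * SB n l - SB n (k-1) * SB n (l+1)).coeff d ∧
    0 ≤ (cB n k * cB n l - cB n (k-1) * cB n (l+1)).coeff d := by
  obtain ⟨j, rfl⟩ : ∃ j, k = j + 1 := ⟨k - 1, by omega⟩
  obtain ⟨e, rfl⟩ : ∃ e, l = j + 1 + e := ⟨l - (j + 1), by omega⟩
  have h1 := SB_key n (j+1) e 0 (by omega) d
  have h2 := cB_key n (j+1) e d
  have e1 : j + 1 + 1 + e = j + 1 + e + 1 := by omega
  rw [e1] at h1 h2
  rw [pow_zero, one_mul] at h1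
  exact ⟨h1, h2⟩
end
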